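/- Let R be an integral domain and let * be a spectral star operation on R, i.e. there is a family 𝓕 of prime ideals of R such that I^* = ⋂_{P ∈ 𝓕} IR_P for every fractional ideal I of R (where IR_P denotes the R_P-submodule of K generated by I, with R_P ⊆ K the localization of R at P). If I is a nonzero ideal of R that is *-finite (I^* = J^* for some nonzero finitely generated R-submodule J of K) and Clifford *-regular, then I is *-stable. -/

import Mathlib

open scoped Pointwise

section Defs

variable (A K : Type*) [CommRing A] [Field K] [Algebra A K]

/-- `I` is a nonzero fractional ideal of `A` (inside `K`):
`I ≠ 0` and `dI ⊆ A` for some nonzero `d ∈ A`. -/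
def IsFrac (I : Submodule A K) : Prop :=
  I ≠ ⊥ ∧ ∃ d : A, d ≠ 0 ∧ ∀ x ∈ I, ∃ a : A, algebraMap A K d * x = algebraMap A K a

/-- The divisorial closure `I^v = (A : (A : I))`; here `(J : I) = J / I` and
`(1 : Submodule A K)` is the image of `A` in `K`. -/
def vS (I : Submodule A K) : Submodule A K := 1 / (1 / I)

/-- The `t`-operation `I^t = ⋃ {J^v : J ⊆ I nonzero finitely generated}` (a directed union,
hence equal to the supremum of submodules). -/
def tS (I : Submodule A K) : Submodule A K :=
  ⨆ J ∈ {J : Submodule A K | J ≠ ⊥ ∧ J.FG ∧ J ≤ I}, vS A K J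

/-- The image of an integral ideal of `A` in `K`. -/
def idealK (I : Ideal A) : Submodule A K := Submodule.map (Algebra.linearMap A K) I

/-- A nonzero (fractional) ideal `I` is stable if `I((I:I):I) = (I:I)`. -/
def IsStableIdeal (I : Submodule A K) : Prop := I * ((I / I) / I) = I / I

/-- `A` is a stable domain: every nonzero (fractional) ideal is stable. -/
def StableDomain : Prop := ∀ I : Submodule A K, IsFrac A K I → IsStableIdeal A K I

/-- `A` is Clifford regular: every nonzero (fractional) ideal `I` satisfies `I = I²J`
for some nonzero `A`-submodule `J` of `K`. -/
def CliffordRegularDomain : Prop :=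
  ∀ I : Submodule A K, IsFrac A K I → ∃ J : Submodule A K, J ≠ ⊥ ∧ I = I * I * J

end Defs
section Star

variable (R K : Type*) [CommRing R] [IsDomain R] [Field K] [Algebra R K] [IsFractionRing R K]

/-- A star operation on the domain `R` with quotient field `K`: a map on (nonzero)
fractional ideals satisfying `(aI)^* = aI^*`, `R^* = R`, `I ⊆ I^*`, monotonicity and
idempotency. -/
structure StarOperation : Type _ where
  star : Submodule R K → Submodule R K
  star_frac : ∀ I, IsFrac R K I → IsFrac R K (star I)
  star_smul : ∀ (a : K), a ≠ 0 → ∀ I, IsFrac R K I → star (a • I) = a • star I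
  star_one : star (1 : Submodule R K) = 1
  le_star : ∀ I, IsFrac R K I → I ≤ star I
  star_mono : ∀ I J, IsFrac R K I → IsFrac R K J → I ≤ J → star I ≤ star J
  star_star : ∀ I, IsFrac R K I → star (star I) = star I

variable {R K}

/-- `*` is of finite type: `I^* = ⋃ {J^* : J ⊆ I nonzero finitely generated}`. -/
def StarOperation.FiniteType (s : StarOperation R K) : Prop :=
  ∀ I, IsFrac R K I →
    s.star I = ⨆ J ∈ {J : Submodule R K | J ≠ ⊥ ∧ J.FG ∧ J ≤ I}, s.star J

/-- `I` is `*`-stable: with `E := (I^* : I^*)`, one has `(I^*(E : I^*))^* = E`. -/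
def StarOperation.Stable (s : StarOperation R K) (I : Submodule R K) : Prop :=
  s.star (s.star I * ((s.star I / s.star I) / s.star I)) = s.star I / s.star I

/-- `I` is Clifford `*`-regular: `I^* = (I²J)^*` for some nonzero ideal `J`. -/
def StarOperation.Regular (s : StarOperation R K) (I : Submodule R K) : Prop :=
  ∃ J : Submodule R K, IsFrac R K J ∧ s.star I = s.star (I * I * J)

/-- `I` is Boole `*`-regular: `(I²)^* = xI^*` for some nonzero `x ∈ K`. -/
def StarOperation.BooleRegular (s : StarOperation R K) (I : Submodule R K) : Prop :=
  ∃ x : K, x ≠ 0 ∧ s.star (I * I) = x • s.star I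

/-- `I` is strongly `*`-stable: `I^* = xE` for some nonzero `x ∈ K`, where `E = (I^* : I^*)`. -/
def StarOperation.StronglyStable (s : StarOperation R K) (I : Submodule R K) : Prop :=
  ∃ x : K, x ≠ 0 ∧ s.star I = x • (s.star I / s.star I)

end Star

/-- `IR_P`: the `R_P`-submodule of `K` generated by `I`, where `R_P ⊆ K` is the localization
of `R` at `P`; concretely it is generated by the elements `x/s` with `x ∈ I`, `s ∉ P`. -/
def locSub (R K : Type*) [CommRing R] [Field K] [Algebra R K] (P : Ideal R)
    (I : Submodule R K) : Submodule R K :=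
  Submodule.span R {z : K | ∃ x ∈ I, ∃ s : R, s ∉ P ∧ z = x * (algebraMap R K s)⁻¹}

/-- `*` is a spectral star operation: there is a family `𝓕` of prime ideals of `R` such that
`I^* = ⋂_{P ∈ 𝓕} IR_P` for every (nonzero) fractional ideal `I`. -/
def StarOperation.Spectral {R K : Type*} [CommRing R] [IsDomain R] [Field K] [Algebra R K]
    [IsFractionRing R K] (s : StarOperation R K) : Prop :=
  ∃ 𝓕 : Set (Ideal R), (∀ P ∈ 𝓕, P.IsPrime) ∧
    ∀ I : Submodule R K, IsFrac R K I → s.star I = ⨅ P ∈ 𝓕, locSub R K P I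

theorem isFrac_iff {R K : Type*} [CommRing R] [IsDomain R] [Field K] [Algebra R K]
    {I : Submodule R K} :
    IsFrac R K I ↔ I ≠ ⊥ ∧ IsFractional (nonZeroDivisors R) I := by
  refine and_congr_right fun _ => ⟨?_, ?_⟩
  · rintro ⟨d, hd, h⟩
    refine ⟨d, mem_nonZeroDivisors_of_ne_zero hd, fun x hx => ?_⟩
    obtain ⟨a, ha⟩ := h x hx
    exact ⟨a, by rw [Algebra.smul_def, ha]⟩
  · rintro ⟨d, hd, h⟩
    refine ⟨d, nonZeroDivisors.ne_zero hd, fun x hx => ?_⟩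
    obtain ⟨a, ha⟩ := h x hx
    exact ⟨a, by rw [ha, Algebra.smul_def]⟩

theorem IsFrac.mono {R K : Type*} [CommRing R] [Field K] [Algebra R K]
    {I J : Submodule R K} (hJ : IsFrac R K J) (hI : I ≠ ⊥) (h : I ≤ J) : IsFrac R K I :=
  let ⟨d, hd, hx⟩ := hJ.2
  ⟨hI, d, hd, fun x hxI => hx x (h hxI)⟩

theorem Submodule.mul_ne_bot_of_field {R K : Type*} [CommRing R] [Field K] [Algebra R K]
    {I J : Submodule R K} (hI : I ≠ ⊥) (hJ : J ≠ ⊥) : I * J ≠ ⊥ := by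
  obtain ⟨x, hx, hx0⟩ := Submodule.exists_mem_ne_zero_of_ne_bot hI
  obtain ⟨y, hy, hy0⟩ := Submodule.exists_mem_ne_zero_of_ne_bot hJ
  exact (Submodule.ne_bot_iff _).2 ⟨x * y, Submodule.mul_mem_mul hx hy, mul_ne_zero hx0 hy0⟩

theorem IsFrac.mul {R K : Type*} [CommRing R] [IsDomain R] [Field K] [Algebra R K]
    {I J : Submodule R K} (hI : IsFrac R K I) (hJ : IsFrac R K J) : IsFrac R K (I * J) :=
  isFrac_iff.2 ⟨Submodule.mul_ne_bot_of_field hI.1 hJ.1,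
    (isFrac_iff.1 hI).2.mul (isFrac_iff.1 hJ).2⟩

theorem IsFrac.div_self {R K : Type*} [CommRing R] [IsDomain R] [Field K] [Algebra R K]
    [IsFractionRing R K] {I : Submodule R K} (hI : IsFrac R K I) : IsFrac R K (I / I) := by
  have hne : I / I ≠ ⊥ := (Submodule.ne_bot_iff _).2
    ⟨1, Submodule.mem_div_iff_forall_mul_mem.2 fun y hy => by rwa [one_mul], one_ne_zero⟩
  refine ⟨hne, ?_⟩
  obtain ⟨x, hx, hx0⟩ := Submodule.exists_mem_ne_zero_of_ne_bot hI.1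
  obtain ⟨d, hd, h⟩ := hI.2
  obtain ⟨c, hc⟩ := h x hx
  have hinj := FaithfulSMul.algebraMap_injective R K
  have hd' : algebraMap R K d ≠ 0 := (map_ne_zero_iff _ hinj).2 hd
  refine ⟨c, ?_, fun e he => ?_⟩
  · rintro rfl
    exact mul_ne_zero hd' hx0 (by simpa using hc)
  · obtain ⟨a, ha⟩ := h _ (Submodule.mem_div_iff_forall_mul_mem.1 he x hx)
    exact ⟨a, by rw [← ha, ← hc]; ring⟩

theorem IsFrac.of_fg {R K : Type*} [CommRing R] [IsDomain R] [Field K] [Algebra R K]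
    [IsFractionRing R K] {I : Submodule R K} (h0 : I ≠ ⊥) (hI : I.FG) : IsFrac R K I :=
  isFrac_iff.2 ⟨h0, FractionalIdeal.isFractional_of_fg hI⟩

section Localization

variable {R K : Type*} [CommRing R] [Field K] [Algebra R K]

theorem one_le_locSub_one {P : Ideal R} (hP : P.IsPrime) :
    (1 : Submodule R K) ≤ locSub R K P 1 := fun x hx =>
  Submodule.subset_span ⟨x, hx, 1, fun h => hP.ne_top ((Ideal.eq_top_iff_one P).2 h), by simp⟩

theorem locSub_eq_mul (P : Ideal R) (I : Submodule R K) :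
    locSub R K P I = I * locSub R K P 1 := by
  apply le_antisymm
  · refine Submodule.span_le.2 ?_
    rintro _ ⟨x, hx, s, hs, rfl⟩
    exact Submodule.mul_mem_mul hx (Submodule.subset_span
      ⟨1, Submodule.one_le.1 le_rfl, s, hs, (one_mul _).symm⟩)
  · rw [← Submodule.span_eq I, locSub, locSub, Submodule.span_mul_span, Submodule.span_eq]
    refine Submodule.span_le.2 ?_
    rintro _ ⟨x, hx, _, ⟨y, hy, s, hs, rfl⟩, rfl⟩
    refine Submodule.subset_span ⟨x * y, ?_, s, hs, (mul_assoc _ _ _).symm⟩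
    simpa using Submodule.mul_mem_mul hx hy

theorem locSub_one_mul_self {P : Ideal R} (hP : P.IsPrime) :
    locSub R K P 1 * locSub R K P 1 = locSub R K P 1 := by
  apply le_antisymm
  · conv_lhs => rw [locSub, Submodule.span_mul_span]
    refine Submodule.span_le.2 ?_
    rintro _ ⟨_, ⟨x, hx, s, hs, rfl⟩, _, ⟨y, hy, t, ht, rfl⟩, rfl⟩
    refine Submodule.subset_span ⟨x * y, by simpa using Submodule.mul_mem_mul hx hy, s * t,
      fun h => (hP.mem_or_mem h).elim hs ht, ?_⟩
    simp only [map_mul, mul_inv]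
    ring
  · exact le_mul_of_one_le_left' (one_le_locSub_one hP)

end Localization

/-- Nakayama's lemma in a field: a multiplicatively closed submodule `M` with `L ≤ M * L` for a
nonzero finitely generated `L` contains `1`. -/
theorem Submodule.one_mem_of_le_mul_of_fg {R K : Type*} [CommRing R] [Field K] [Algebra R K]
    {M L : Submodule R K} (hM : M * M ≤ M) (hL : L.FG) (hL0 : L ≠ ⊥) (h : L ≤ M * L) :
    (1 : K) ∈ M := by
  let B : Subring K :=
    { carrier := {x | ∀ m ∈ M, x * m ∈ M}
      mul_mem' := fun {a b} ha hb m hm => by rw [mul_assoc]; exact ha _ (hb _ hm)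
      one_mem' := fun m hm => by rwa [one_mul]
      add_mem' := fun {a b} ha hb m hm => by rw [add_mul]; exact M.add_mem (ha _ hm) (hb _ hm)
      zero_mem' := fun m _ => by rw [zero_mul]; exact M.zero_mem
      neg_mem' := fun {a} ha m hm => by rw [neg_mul]; exact M.neg_mem (ha _ hm) }
  have hMB : ∀ m ∈ M, m ∈ B := fun m hm n hn => hM (Submodule.mul_mem_mul hm hn)
  let a : Ideal B :=
    { carrier := {x | (x : K) ∈ M}
      add_mem' := fun {x y} hx hy => M.add_mem hx hy
      zero_mem' := M.zero_mem
      smul_mem' := fun c x hx => c.2 _ hx }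
  obtain ⟨S, rfl⟩ := hL
  let N : Submodule B K := Submodule.span B (S : Set K)
  have hRB : ∀ r : R, algebraMap R K r ∈ B := fun r m hm => by
    rw [← Algebra.smul_def]; exact M.smul_mem r hm
  have hLN : ∀ x ∈ Submodule.span R (S : Set K), x ∈ N := fun x hx => by
    induction hx using Submodule.span_induction with
    | mem x hx => exact Submodule.subset_span hx
    | zero => exact N.zero_mem
    | add x y _ _ hx hy => exact N.add_mem hx hy
    | smul r x _ hx => rw [Algebra.smul_def]; exact N.smul_mem ⟨_, hRB r⟩ hx
  have hN : N ≤ a • N := by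
    refine Submodule.span_le.2 fun x hx => ?_
    refine Submodule.mul_induction_on (h (Submodule.subset_span hx)) (fun m hm l hl => ?_)
      fun _ _ => Submodule.add_mem _
    have hma : (⟨m, hMB m hm⟩ : B) ∈ a := hm
    exact Submodule.smul_mem_smul hma (hLN l hl)
  obtain ⟨r, hr, hrN⟩ := Submodule.exists_sub_one_mem_and_smul_eq_zero_of_fg_of_le_smul a N
    ⟨S, rfl⟩ hN
  obtain ⟨x, hx, hx0⟩ := Submodule.exists_mem_ne_zero_of_ne_bot hL0
  have hr0 : (r : K) = 0 := (mul_eq_zero.1 (hrN x (hLN x hx))).resolve_right hx0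
  have h1 : (r : K) - 1 ∈ M := hr
  rw [hr0, zero_sub] at h1
  exact M.neg_mem_iff.1 h1

/-- If `*` is a spectral star operation on `R` and `I` is a nonzero
`*`-finite Clifford `*`-regular ideal of `R`, then `I` is `*`-stable. -/
theorem star_finite_regular_implies_stable
    {R K : Type*} [CommRing R] [IsDomain R] [Field K] [Algebra R K] [IsFractionRing R K]
    (s : StarOperation R K) (hspec : s.Spectral)
    (I : Submodule R K) (hI : IsFrac R K I)
    (hfin : ∃ J : Submodule R K, J ≠ ⊥ ∧ J.FG ∧ s.star I = s.star J)
    (hreg : s.Regular I) :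
    s.Stable I := by
  obtain ⟨𝓕, hprime, hF⟩ := hspec
  obtain ⟨L, hL0, hLfg, hIL⟩ := hfin
  obtain ⟨J, hJ, hIJ⟩ := hreg
  have hL := IsFrac.of_fg hL0 hLfg
  have hIIJ := (hI.mul hI).mul hJ
  have hstar_mul : ∀ A, IsFrac R K A → ∀ P ∈ 𝓕,
      s.star A * locSub R K P 1 = A * locSub R K P 1 := fun A hA P hP => by
    apply le_antisymm
    · have h1 : s.star A ≤ A * locSub R K P 1 := by
        rw [hF A hA, ← locSub_eq_mul]
        exact iInf₂_le P hP
      calc s.star A * locSub R K P 1 ≤ A * locSub R K P 1 * locSub R K P 1 := by gcongr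
        _ = A * locSub R K P 1 := by rw [mul_assoc, locSub_one_mul_self (hprime P hP)]
    · gcongr
      exact s.le_star A hA
  have hle_star : ∀ A B, IsFrac R K A →
      (∀ P ∈ 𝓕, B * locSub R K P 1 ≤ A * locSub R K P 1) → B ≤ s.star A := fun A B hA h => by
    rw [hF A hA]
    refine le_iInf₂ fun P hP => ?_
    rw [locSub_eq_mul]
    exact (le_mul_of_one_le_right' (one_le_locSub_one (hprime P hP))).trans (h P hP)
  unfold StarOperation.Stable
  set S := s.star I with hS
  have hSfrac : IsFrac R K S := s.star_frac I hI
  have hE : IsFrac R K (S / S) := hSfrac.div_self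
  have hES : S / S * S ≤ S := Submodule.le_div_iff_mul_le.1 le_rfl
  have hST : ∀ P ∈ 𝓕, S * locSub R K P 1 = I * locSub R K P 1 := hstar_mul I hI
  have hIIJT : ∀ P ∈ 𝓕, I * I * J * locSub R K P 1 = I * locSub R K P 1 := fun P hP => by
    rw [← hST P hP, hIJ, hstar_mul _ hIIJ P hP]
  have hJE : J ≤ S / S / S := by
    rw [Submodule.le_div_iff_mul_le, Submodule.le_div_iff_mul_le]
    refine hle_star I _ hI fun P hP => le_of_eq ?_
    have hT := locSub_one_mul_self (K := K) (hprime P hP)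
    calc J * S * S * locSub R K P 1
        = (S * locSub R K P 1) * (S * locSub R K P 1) * J := by
          conv_lhs => rw [← hT]
          ring
      _ = I * I * J * (locSub R K P 1 * locSub R K P 1) := by rw [hST P hP]; ring
      _ = I * locSub R K P 1 := by rw [hT, hIIJT P hP]
  have hSJ : S * J ≤ S * (S / S / S) := by gcongr
  have hprod_le : S * (S / S / S) ≤ S / S := by
    rw [mul_comm]
    exact Submodule.le_div_iff_mul_le.1 le_rfl
  have hprod : IsFrac R K (S * (S / S / S)) :=
    hE.mono (ne_bot_of_le_ne_bot (Submodule.mul_ne_bot_of_field hSfrac.1 hJ.1) hSJ) hprod_le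
  apply le_antisymm
  · rw [Submodule.le_div_iff_mul_le]
    refine hle_star I _ hI fun P hP => ?_
    calc s.star (S * (S / S / S)) * S * locSub R K P 1
        = s.star (S * (S / S / S)) * locSub R K P 1 * S := by ring
      _ = S * (S / S / S) * S * locSub R K P 1 := by rw [hstar_mul _ hprod P hP]; ring
      _ ≤ S * locSub R K P 1 := by
          gcongr
          exact (mul_le_mul_left hprod_le S).trans hES
      _ = I * locSub R K P 1 := hST P hP
  · refine hle_star _ _ hprod fun P hP => ?_
    have hT := locSub_one_mul_self (K := K) (hprime P hP)
    set T := locSub R K P 1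
    have h1T : 1 ≤ T := one_le_locSub_one (hprime P hP)
    have hLT : L * T = I * T := by rw [← hST P hP, hIL, hstar_mul L hL P hP]
    have hone : (1 : K) ∈ I * J * T := by
      refine Submodule.one_mem_of_le_mul_of_fg (le_of_eq ?_) hLfg hL0 ?_
      · calc I * J * T * (I * J * T) = (I * I * J * T) * (J * T) := by ring
          _ = I * J * (T * T) := by rw [hIIJT P hP]; ring
          _ = I * J * T := by rw [hT]
      · calc L ≤ L * T := le_mul_of_one_le_right' h1T
          _ = I * I * J * (T * T) := by rw [hLT, ← hIIJT P hP, hT]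
          _ = (I * T) * (I * J * T) := by ring
          _ = I * J * (T * T) * L := by rw [← hLT]; ring
          _ = I * J * T * L := by rw [hT]
    calc S / S * T ≤ S / S * T * (I * J * T) :=
          le_mul_of_one_le_right' (Submodule.one_le.2 hone)
      _ = S / S * J * (I * (T * T)) := by ring
      _ = S / S * S * (J * T) := by rw [hT, ← hST P hP]; ring
      _ ≤ S * (J * T) := by gcongr
      _ = S * J * T := by ring
      _ ≤ S * (S / S / S) * T := by gcongr
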